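/- Let G and H be groups, g ∈ G with g ≠ 1, and h ∈ H with h ≠ 1. In the free product G * H, for natural numbers m and n, if (inl g * inr h)^m is conjugate to (inl g * inr h)^n, then m = n. In particular the powers of inl g * inr h are pairwise non-conjugate. -/

import Mathlib

namespace Monoid.CoprodI

section Word

variable {ι : Type*} {M : ι → Type*} [∀ i, Monoid (M i)] [∀ i, DecidableEq (M i)]

theorem Word.length_toList_tail_le_rcons {i : ι} (p : Word.Pair M i) :
    p.tail.toList.length ≤ (Word.rcons p).toList.length := by
  unfold Word.rcons
  split_ifs <;> simp [Word.cons]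

theorem Word.length_toList_rcons_le {i : ι} (p : Word.Pair M i) :
    (Word.rcons p).toList.length ≤ p.tail.toList.length + 1 := by
  unfold Word.rcons
  split_ifs <;> simp [Word.cons]

variable [DecidableEq ι]

theorem length_toList_of_smul_le {i : ι} (a : M i) (w : Word M) :
    (of a • w).toList.length ≤ w.toList.length + 1 := by
  rw [Word.of_smul_def]
  refine (Word.length_toList_rcons_le _).trans (Nat.add_le_add_right ?_ 1)
  calc (Word.equivPair i w).tail.toList.length
      ≤ (Word.rcons (Word.equivPair i w)).toList.length := Word.length_toList_tail_le_rcons _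
    _ = w.toList.length := by rw [← Word.equivPair_symm, Equiv.symm_apply_apply]

theorem exists_length_toList_smul_le (x : CoprodI M) :
    ∃ C : ℕ, ∀ w : Word M, (x • w).toList.length ≤ w.toList.length + C := by
  induction x using CoprodI.induction_on with
  | one => exact ⟨0, fun w => by simp⟩
  | of i a => exact ⟨1, length_toList_of_smul_le a⟩
  | mul x y hx hy =>
    obtain ⟨C, hC⟩ := hx
    obtain ⟨D, hD⟩ := hy
    refine ⟨D + C, fun w => ?_⟩
    rw [mul_smul]
    have h₁ := hC (y • w)
    have h₂ := hD w
    lia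

theorem length_toList_of_mul_of_pow_smul_le {i j : ι} (a : M i) (b : M j) (n : ℕ) (w : Word M) :
    ((of a * of b) ^ n • w).toList.length ≤ w.toList.length + 2 * n := by
  induction n with
  | zero => simp
  | succ n ih =>
    rw [pow_succ', mul_smul, mul_smul]
    have h₁ := length_toList_of_smul_le a (of b • (of a * of b) ^ n • w)
    have h₂ := length_toList_of_smul_le b ((of a * of b) ^ n • w)
    lia

theorem length_toList_of_mul_of_pow_smul_empty {i j : ι} (hij : i ≠ j) {a : M i} {b : M j}
    (ha : a ≠ 1) (hb : b ≠ 1) (n : ℕ) :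
    ((of a * of b) ^ n • (Word.empty : Word M)).fstIdx ≠ some j ∧
      ((of a * of b) ^ n • (Word.empty : Word M)).toList.length = 2 * n := by
  induction n with
  | zero => simp [Word.fstIdx, Word.empty]
  | succ n ih =>
    obtain ⟨hj, hlen⟩ := ih
    have hi : (Word.cons b _ hj hb).fstIdx ≠ some i := by simpa using hij.symm
    rw [pow_succ', mul_smul, mul_smul, ← Word.cons_eq_smul (h1 := hj) (h2 := hb),
      ← Word.cons_eq_smul (h1 := hi) (h2 := ha)]
    refine ⟨by simpa using hij, ?_⟩
    simp only [Word.cons, List.length_cons, hlen]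
    lia

end Word

variable {ι : Type*} {G : ι → Type*} [∀ i, Group (G i)]

theorem le_of_isConj_of_mul_of_pow {i j : ι} (hij : i ≠ j) {a : G i} {b : G j}
    (ha : a ≠ 1) (hb : b ≠ 1) {m n : ℕ}
    (hconj : IsConj ((of a * of b : CoprodI G) ^ m) ((of a * of b) ^ n)) : n ≤ m := by
  classical
  obtain ⟨u, hu⟩ := isConj_iff.mp hconj
  obtain ⟨C, hC⟩ := exists_length_toList_smul_le u
  set D := (u⁻¹ • (Word.empty : Word G)).toList.length with hD
  have key (k : ℕ) : 2 * (n * k) ≤ D + 2 * (m * k) + C := by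
    have hk : (of a * of b : CoprodI G) ^ (n * k) = u * (of a * of b) ^ (m * k) * u⁻¹ := by
      rw [pow_mul, ← hu, conj_pow, ← pow_mul]
    rw [← (length_toList_of_mul_of_pow_smul_empty hij ha hb (n * k)).2, hk, mul_smul, mul_smul]
    exact (hC _).trans
      (Nat.add_le_add_right (length_toList_of_mul_of_pow_smul_le a b (m * k) _) C)
  by_contra! hlt
  have hmul := Nat.mul_le_mul_right (D + C + 1) (Nat.succ_le_of_lt hlt)
  have hkey := key (D + C + 1)
  rw [Nat.succ_mul] at hmul
  lia

theorem isConj_of_mul_of_pow_iff {i j : ι} (hij : i ≠ j) {a : G i} {b : G j}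
    (ha : a ≠ 1) (hb : b ≠ 1) {m n : ℕ} :
    IsConj ((of a * of b : CoprodI G) ^ m) ((of a * of b) ^ n) ↔ m = n :=
  ⟨fun h => (le_of_isConj_of_mul_of_pow hij ha hb h.symm).antisymm
    (le_of_isConj_of_mul_of_pow hij ha hb h), fun h => h ▸ IsConj.refl _⟩

end Monoid.CoprodI

namespace Monoid.Coprod

variable (G H : Type*) [Group G] [Group H]

/-- The two factors of `G ∗ H`, as a family of subgroups. -/
def factor : Bool → Subgroup (Coprod G H)
  | false => (inl : G →* Coprod G H).range
  | true => (inr : H →* Coprod G H).range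

/-- The map from the binary free product to the indexed free product of its factors. -/
def toCoprodI : Coprod G H →* CoprodI (fun i => factor G H i) :=
  lift
    ((CoprodI.of (M := fun i => factor G H i) (i := false)).comp
      (inl : G →* Coprod G H).rangeRestrict)
    ((CoprodI.of (M := fun i => factor G H i) (i := true)).comp
      (inr : H →* Coprod G H).rangeRestrict)

end Monoid.Coprod

open Monoid.Coprod in
/-- In the free product `G ∗ H` of groups, for `g ≠ 1` and `h ≠ 1`, distinct powers of
`inl g * inr h` are non-conjugate: if `(inl g * inr h)^m` is conjugate to
`(inl g * inr h)^n`, then `m = n`. -/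
theorem freeProduct_pow_isConj_iff_eq (G H : Type*) [Group G] [Group H]
    (g : G) (hg : g ≠ 1) (h : H) (hh : h ≠ 1) (m n : ℕ)
    (hconj : IsConj ((Monoid.Coprod.inl g * Monoid.Coprod.inr h : Monoid.Coprod G H) ^ m)
      ((Monoid.Coprod.inl g * Monoid.Coprod.inr h : Monoid.Coprod G H) ^ n)) :
    m = n := by
  have ha : (inl : G →* Monoid.Coprod G H).rangeRestrict g ≠ 1 := fun h1 =>
    hg (inl_injective (by simpa using congrArg Subtype.val h1))
  have hb : (inr : H →* Monoid.Coprod G H).rangeRestrict h ≠ 1 := fun h1 =>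
    hh (inr_injective (by simpa using congrArg Subtype.val h1))
  have hmap := (toCoprodI G H).map_isConj hconj
  simp only [map_pow, map_mul, toCoprodI, lift_apply_inl, lift_apply_inr] at hmap
  exact (Monoid.CoprodI.isConj_of_mul_of_pow_iff (G := fun i => factor G H i)
    Bool.false_ne_true ha hb).mp hmap
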